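/- arXiv:1712.03448 — 3 statements merged into one kernel-verified Lean document; each statement's English description precedes it below -/
import Mathlib

section
/- Let π be a choice rule and let ≻ be a preference on X such that a P b implies a ≻ b for all a, b (i.e., ≻ extends the relation P). Then there exists a monotonic attention rule μ such that (≻, μ) is a RAM representation of π. -/
open Finset
open scoped Classical

variable {α : Type*} [Fintype α] [DecidableEq α]

/-- A choice rule: for every choice problem (nonempty finite set) `S`,
`π S` is a probability distribution supported on `S`. -/
def IsChoiceRule (π : Finset α → α → ℝ) : Prop :=
  ∀ S : Finset α, S.Nonempty →
    (∀ a ∈ S, 0 ≤ π S a) ∧ (∀ a, a ∉ S → π S a = 0) ∧ (∑ a ∈ S, π S a) = 1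

/-- An attention rule: for every choice problem `S`, `μ S` is a probability
distribution over the nonempty subsets of `S`.  `μ S T` is the probability of
paying attention to the consideration set `T` when the choice problem is `S`. -/
def IsAttentionRule (μ : Finset α → Finset α → ℝ) : Prop :=
  ∀ S : Finset α, S.Nonempty →
    (∀ T : Finset α, T ⊆ S → T.Nonempty → 0 ≤ μ S T) ∧
    (∀ T : Finset α, ¬(T ⊆ S ∧ T.Nonempty) → μ S T = 0) ∧
    (∑ T ∈ S.powerset, μ S T) = 1

/-- Assumption 1 (Monotonic attention): `μ(T|S) ≤ μ(T|S−a)` for `a ∈ S − T`. -/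
def MonotonicAttention (μ : Finset α → Finset α → ℝ) : Prop :=
  ∀ S T : Finset α, S.Nonempty → T ⊆ S → T.Nonempty →
    ∀ a ∈ S, a ∉ T → μ S T ≤ μ (S.erase a) T

/-- A preference: a strict linear order (asymmetric, transitive, complete). -/
structure IsPref (r : α → α → Prop) : Prop where
  asymm : ∀ a b, r a b → ¬ r b a
  trans : ∀ a b c, r a b → r b c → r a c
  total : ∀ a b, a ≠ b → r a b ∨ r b a

/-- `a` is the `r`-maximal element of `T`. -/
def IsBest (r : α → α → Prop) (a : α) (T : Finset α) : Prop :=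
  a ∈ T ∧ ∀ b ∈ T, b ≠ a → r a b

/-- `(r, μ)` represents `π` (without the monotonicity requirement on `μ`):
`π(a|S) = Σ_{T ⊆ S} 1(a is r-best in T) μ(T|S)`. -/
noncomputable def Represents (π : Finset α → α → ℝ) (r : α → α → Prop)
    (μ : Finset α → Finset α → ℝ) : Prop :=
  IsChoiceRule π ∧ IsPref r ∧ IsAttentionRule μ ∧
  ∀ S : Finset α, S.Nonempty → ∀ a ∈ S,
    π S a = ∑ T ∈ S.powerset, if IsBest r a T then μ S T else 0

/-- `(r, μ)` is a RAM representation of `π`: a representation with `μ` monotonic. -/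
def IsRAM (π : Finset α → α → ℝ) (r : α → α → Prop)
    (μ : Finset α → Finset α → ℝ) : Prop :=
  Represents π r μ ∧ MonotonicAttention μ

/-- The revealed-preference relation `P`: `a P b` iff `a ≠ b` and there is a
choice problem `S` containing `a` and `b` with `π(a|S) > π(a|S−b)`. -/
def Prel (π : Finset α → α → ℝ) (a b : α) : Prop :=
  a ≠ b ∧ ∃ S : Finset α, a ∈ S ∧ b ∈ S ∧ π S a > π (S.erase b) a

/-- Lower contour set of `a` with respect to the preference `r`. -/
noncomputable def lowerContour (r : α → α → Prop) (a : α) : Finset α :=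
  Finset.univ.filter fun b => b = a ∨ r a b

/-- An attention rule is triangular w.r.t. `r` if it puts weight only on
(intersections of `S` with) lower contour sets. -/
def Triangular (r : α → α → Prop) (μ : Finset α → Finset α → ℝ) : Prop :=
  ∀ S T : Finset α, S.Nonempty → 0 < μ S T → ∃ a ∈ S, T = lowerContour r a ∩ S

/-- A (deterministic) attention filter. -/
def IsAttentionFilter (Γ : Finset α → Finset α) : Prop :=
  ∀ S : Finset α, S.Nonempty →
    Γ S ⊆ S ∧ (Γ S).Nonempty ∧
    ∀ a ∈ S, a ∉ Γ S → (S.erase a).Nonempty → Γ (S.erase a) = Γ S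

/-- An attention filter is triangular w.r.t. `r` if each `Γ(S)` is the
intersection of `S` with a lower contour set of some element of `S`. -/
def TriangularFilter (r : α → α → Prop) (Γ : Finset α → Finset α) : Prop :=
  ∀ S : Finset α, S.Nonempty → ∃ a ∈ S, Γ S = lowerContour r a ∩ S

/-- Assumption 3 (φ-attentive at binaries). -/
def AttentiveAtBinaries (φ : ℝ) (μ : Finset α → Finset α → ℝ) : Prop :=
  ∀ a b : α, a ≠ b →
    μ {a, b} {a, b} ≥ (1 - φ) / φ * max (μ {a, b} {a}) (μ {a, b} {b})

/-- A deterministic attention rule. -/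
def Deterministic (μ : Finset α → Finset α → ℝ) : Prop :=
  ∀ S T : Finset α, S.Nonempty → μ S T = 0 ∨ μ S T = 1

theorem self_mem_lowerContour (r : α → α → Prop) (a : α) : a ∈ lowerContour r a := by
  simp [lowerContour]

theorem isBest_lowerContour_inter_iff {r : α → α → Prop} (hr : IsPref r) {S : Finset α} {a b : α}
    (hb : b ∈ S) : IsBest r a (lowerContour r b ∩ S) ↔ b = a := by
  constructor
  · rintro ⟨ha, hmax⟩
    by_contra hne
    have hab : r a b := hmax b (mem_inter.2 ⟨self_mem_lowerContour r b, hb⟩) hne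
    have ha' : a = b ∨ r b a := by simpa [lowerContour] using (mem_inter.1 ha).1
    exact ha'.elim (fun h => hne h.symm) (hr.asymm a b hab)
  · rintro rfl
    refine ⟨mem_inter.2 ⟨self_mem_lowerContour r b, hb⟩, fun c hc hne => ?_⟩
    have hc' : c = b ∨ r b c := by simpa [lowerContour] using (mem_inter.1 hc).1
    exact hc'.resolve_left hne

/-- The attention rule that, at `S`, considers the part of `S` weakly below `a` with
probability `π S a`. -/
noncomputable def triangularAttention (π : Finset α → α → ℝ) (r : α → α → Prop)
    (S T : Finset α) : ℝ :=
  ∑ a ∈ S, if lowerContour r a ∩ S = T then π S a else 0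

theorem sum_powerset_mul_triangularAttention (π : Finset α → α → ℝ) (r : α → α → Prop)
    (S : Finset α) (w : Finset α → ℝ) :
    ∑ T ∈ S.powerset, w T * triangularAttention π r S T =
      ∑ a ∈ S, w (lowerContour r a ∩ S) * π S a := by
  simp only [triangularAttention, mul_sum]
  rw [sum_comm]
  refine sum_congr rfl fun a _ => ?_
  simp [mul_ite]

theorem isAttentionRule_triangularAttention {π : Finset α → α → ℝ} (hπ : IsChoiceRule π)
    (r : α → α → Prop) : IsAttentionRule (triangularAttention π r) := by
  intro S hS
  obtain ⟨hnonneg, -, hsum⟩ := hπ S hS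
  refine ⟨fun T _ _ => sum_nonneg fun a ha => ?_, fun T hT => sum_eq_zero fun a ha => ?_, ?_⟩
  · split_ifs
    exacts [hnonneg a ha, le_rfl]
  · refine if_neg fun h => hT ?_
    subst h
    exact ⟨inter_subset_right, a, mem_inter.2 ⟨self_mem_lowerContour r a, ha⟩⟩
  · simpa [hsum] using sum_powerset_mul_triangularAttention π r S fun _ => 1

theorem represents_triangularAttention {π : Finset α → α → ℝ} {r : α → α → Prop}
    (hπ : IsChoiceRule π) (hr : IsPref r) : Represents π r (triangularAttention π r) := by
  refine ⟨hπ, hr, isAttentionRule_triangularAttention hπ r, fun S _ a ha => ?_⟩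
  have h := sum_powerset_mul_triangularAttention π r S fun T => if IsBest r a T then 1 else 0
  simp only [ite_mul, one_mul, zero_mul] at h
  rw [h, sum_eq_single_of_mem a ha fun b hb hne =>
    if_neg (mt (isBest_lowerContour_inter_iff hr hb).1 hne),
    if_pos ((isBest_lowerContour_inter_iff hr ha).2 rfl)]

theorem monotonicAttention_triangularAttention {π : Finset α → α → ℝ} {r : α → α → Prop}
    (hπ : IsChoiceRule π) (hext : ∀ a b : α, Prel π a b → r a b) :
    MonotonicAttention (triangularAttention π r) := by
  intro S T _ _ _ x hx hxT
  have hzero : (if lowerContour r x ∩ S = T then π S x else 0) = 0 :=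
    by
    refine if_neg fun h => hxT ?_
    rw [← h]
    exact mem_inter.2 ⟨self_mem_lowerContour r x, hx⟩
  rw [triangularAttention, ← add_sum_erase S _ hx, hzero, zero_add]
  refine sum_le_sum fun a ha => ?_
  obtain ⟨hax, haS⟩ := mem_erase.1 ha
  by_cases h : lowerContour r a ∩ S = T
  · have h' : lowerContour r a ∩ S.erase x = T := by
      rw [inter_erase, h, erase_eq_of_notMem hxT]
    rw [if_pos h, if_pos h']
    by_contra hlt
    refine hxT (h ▸ mem_inter.2 ⟨?_, hx⟩)
    simpa [lowerContour] using Or.inr (hext a x ⟨hax, S, haS, hx, not_le.1 hlt⟩)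
  · rw [if_neg h]
    split_ifs
    exacts [(hπ _ ⟨a, ha⟩).1 a ha, le_rfl]

/-- If a preference `≻` extends the revealed-preference relation
`P` of the choice rule `π`, then there is a monotonic attention rule `μ` such
that `(≻, μ)` is a RAM representation of `π`. -/
theorem stmt3 (π : Finset α → α → ℝ) (r : α → α → Prop)
    (hπ : IsChoiceRule π) (hr : IsPref r)
    (hext : ∀ a b : α, Prel π a b → r a b) :
    ∃ μ : Finset α → Finset α → ℝ, IsRAM π r μ := by
  exact ⟨triangularAttention π r, represents_triangularAttention hπ hr,
    monotonicAttention_triangularAttention hπ hext⟩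
end

section
/- (Theorem 5, Characterization with binary attentiveness) Fix φ ∈ [1/2, 1]. A choice rule π has a RAM representation (≻, μ) in which μ is monotonic and φ-attentive at binaries if and only if the relation P^φ ∪ P has no cycle. -/
open Finset
open scoped Classical

variable {α : Type*} [Fintype α] [DecidableEq α]

lemma IsPref.irrefl {β : Type*} {r : β → β → Prop} (hr : IsPref r) (a : β) : ¬ r a a :=
  fun h => hr.asymm a a h h

lemma exists_isPref_extending {β : Type*} {R : β → β → Prop}
    (hR : ∀ a, ¬ Relation.TransGen R a a) :
    ∃ r : β → β → Prop, IsPref r ∧ ∀ a b, R a b → r a b := by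
  have hpo : IsPartialOrder β (Relation.ReflTransGen R) :=
    { refl := fun _ => .refl
      trans := fun _ _ _ => .trans
      antisymm := fun a b hab hba => by
        rcases Relation.reflTransGen_iff_eq_or_transGen.1 hab with h | h
        · exact h.symm
        · exact (hR a (h.trans_left hba)).elim }
  obtain ⟨s, hs, hle⟩ := extend_partialOrder (Relation.ReflTransGen R)
  refine ⟨fun a b => s a b ∧ a ≠ b, ⟨?_, ?_, ?_⟩, ?_⟩
  · rintro a b ⟨h, hne⟩ ⟨h', -⟩
    exact hne (hs.antisymm a b h h')
  · rintro a b c ⟨h, hne⟩ ⟨h', -⟩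
    refine ⟨hs.trans a b c h h', ?_⟩
    rintro rfl
    exact hne (hs.antisymm a b h h')
  · intro a b hne
    exact (hs.total a b).imp (fun h => ⟨h, hne⟩) (fun h => ⟨h, hne.symm⟩)
  · intro a b h
    refine ⟨hle a b (.single h), ?_⟩
    rintro rfl
    exact hR a (.single h)

lemma Prel.pref {β : Type*} [DecidableEq β] {π : Finset β → β → ℝ}
    {r : β → β → Prop} {μ : Finset β → Finset β → ℝ} (h : IsRAM π r μ)
    {a b : β} (hP : Prel π a b) : r a b := by
  obtain ⟨⟨-, -, -, hrep⟩, hmono⟩ := h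
  obtain ⟨hne, S, haS, hbS, hgt⟩ := hP
  by_contra hnot
  have haS' : a ∈ S.erase b := mem_erase.2 ⟨hne, haS⟩
  refine absurd hgt (not_lt.2 ?_)
  rw [hrep S ⟨a, haS⟩ a haS, hrep (S.erase b) ⟨a, haS'⟩ a haS',
    ← sum_subset (powerset_mono.2 (erase_subset b S))]
  · refine sum_le_sum fun T hT => ?_
    have hTS := mem_powerset.1 hT
    split_ifs with hbest
    · exact hmono S T ⟨a, haS⟩ (hTS.trans (erase_subset b S)) ⟨a, hbest.1⟩ b hbS
        fun hbT => notMem_erase b S (hTS hbT)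
    · exact le_rfl
  · intro T hT hT'
    refine if_neg fun hbest => hT' (mem_powerset.2 fun x hx => mem_erase.2 ⟨?_, ?_⟩)
    · rintro rfl
      exact hnot (hbest.2 x hx hne.symm)
    · exact mem_powerset.1 hT hx

lemma pref_of_lt_binary {β : Type*} [DecidableEq β] {φ : ℝ} (hφ : 0 < φ)
    {π : Finset β → β → ℝ} {r : β → β → Prop} {μ : Finset β → Finset β → ℝ}
    (h : Represents π r μ) (hatt : AttentiveAtBinaries φ μ)
    {a b : β} (hne : a ≠ b) (hlt : φ < π {a, b} a) : r a b := by
  obtain ⟨-, -, hμ, hrep⟩ := h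
  by_contra hnot
  have hne_ab : ({a, b} : Finset β).Nonempty := ⟨a, by simp⟩
  obtain ⟨hpos, -, hsum⟩ := hμ {a, b} hne_ab
  have hπa : π {a, b} a = μ {a, b} {a} := by
    rw [hrep {a, b} hne_ab a (by simp), sum_eq_single {a}]
    · exact if_pos ⟨by simp, by simp⟩
    · intro T hT hTa
      refine if_neg fun hbest => hTa (eq_singleton_iff_unique_mem.2 ⟨hbest.1, fun x hx => ?_⟩)
      by_contra hxa
      have hxb : x = b := by
        have := mem_powerset.1 hT hx
        simpa [hxa] using this
      exact hnot (hxb ▸ hbest.2 x hx hxa)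
    · simp
  have hle : μ {a, b} {a} + μ {a, b} {a, b} ≤ 1 := by
    have hsets : ({a} : Finset β) ≠ {a, b} := fun h => hne.symm <| by
      have : b ∈ ({a} : Finset β) := h ▸ by simp
      simpa using this
    rw [← hsum, ← sum_pair hsets]
    refine sum_le_sum_of_subset_of_nonneg ?_ fun T hT _ => ?_
    · intro T hT
      rcases mem_insert.1 hT with rfl | hT
      · simp
      · simp [mem_singleton.1 hT]
    · rcases T.eq_empty_or_nonempty with rfl | hT'
      · exact ((hμ {a, b} hne_ab).2.1 ∅ (by simp)).ge
      · exact hpos T (mem_powerset.1 hT) hT'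
  have hatt' := hatt a b hne
  have hmax := le_max_left (μ {a, b} {a}) (μ {a, b} {b})
  rw [hπa] at hlt
  rcases le_or_gt φ 1 with hφ1 | hφ1
  · have hcoef : 0 ≤ (1 - φ) / φ := div_nonneg (by linarith) hφ.le
    have h1 := mul_le_mul_of_nonneg_left (hlt.le.trans hmax) hcoef
    rw [div_mul_cancel₀ _ hφ.ne'] at h1
    linarith
  · have := hpos {a, b} Subset.rfl hne_ab
    linarith

/-- The triangular attention rule that pays attention to the part of `S` weakly below `a` with
probability `π S a`. -/
noncomputable def triangularRule (π : Finset α → α → ℝ) (r : α → α → Prop)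
    (S T : Finset α) : ℝ :=
  ∑ a ∈ S, if T = lowerContour r a ∩ S then π S a else 0

section TriangularRule

variable {π : Finset α → α → ℝ} {r : α → α → Prop}

lemma mem_lowerContour {a b : α} : b ∈ lowerContour r a ↔ b = a ∨ r a b := by
  simp [lowerContour]

lemma isBest_lowerContour_inter (hr : IsPref r) {S : Finset α} {a b : α} (hb : b ∈ S) :
    IsBest r a (lowerContour r b ∩ S) ↔ a = b := by
  constructor
  · rintro ⟨ha, hbest⟩
    by_contra hne
    have hba := (mem_lowerContour.1 (mem_inter.1 ha).1).resolve_left hne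
    exact hr.asymm b a hba
      (hbest b (mem_inter.2 ⟨mem_lowerContour.2 (.inl rfl), hb⟩) (Ne.symm hne))
  · rintro rfl
    exact ⟨mem_inter.2 ⟨mem_lowerContour.2 (.inl rfl), hb⟩, fun c hc hca =>
      (mem_lowerContour.1 (mem_inter.1 hc).1).resolve_left hca⟩

lemma triangularRule_lowerContour (hr : IsPref r) {S : Finset α} {a : α} (ha : a ∈ S) :
    triangularRule π r S (lowerContour r a ∩ S) = π S a := by
  rw [triangularRule, sum_eq_single a]
  · exact if_pos rfl
  · intro b hb hba
    refine if_neg fun h => hba ?_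
    have hbest := (isBest_lowerContour_inter hr hb).2 rfl
    rw [← h] at hbest
    exact (isBest_lowerContour_inter hr ha).1 hbest
  · exact fun h => (h ha).elim

lemma triangularRule_eq_zero {S T : Finset α} (h : ∀ a ∈ S, T ≠ lowerContour r a ∩ S) :
    triangularRule π r S T = 0 :=
  sum_eq_zero fun a ha => if_neg (h a ha)

lemma triangularRule_nonneg (hπ : IsChoiceRule π) (S T : Finset α) :
    0 ≤ triangularRule π r S T := by
  refine sum_nonneg fun a ha => ?_
  split_ifs
  · exact (hπ S ⟨a, ha⟩).1 a ha
  · exact le_rfl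

lemma isAttentionRule_triangularRule (hπ : IsChoiceRule π) :
    IsAttentionRule (triangularRule π r) := by
  refine fun S hS => ⟨fun T _ _ => triangularRule_nonneg hπ S T, fun T hT => ?_, ?_⟩
  · refine triangularRule_eq_zero fun a ha h => hT ⟨h ▸ inter_subset_right, a, ?_⟩
    exact h ▸ mem_inter.2 ⟨mem_lowerContour.2 (.inl rfl), ha⟩
  · simp only [triangularRule]
    rw [sum_comm, ← (hπ S hS).2.2]
    refine sum_congr rfl fun a _ => ?_
    rw [sum_ite_eq', if_pos (mem_powerset.2 inter_subset_right)]

lemma represents_triangularRule (hπ : IsChoiceRule π) (hr : IsPref r) :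
    Represents π r (triangularRule π r) := by
  refine ⟨hπ, hr, isAttentionRule_triangularRule hπ, fun S hS a ha => ?_⟩
  rw [sum_eq_single (lowerContour r a ∩ S), if_pos ((isBest_lowerContour_inter hr ha).2 rfl),
    triangularRule_lowerContour hr ha]
  · intro T _ hT
    split_ifs with hbest
    · refine triangularRule_eq_zero fun b hb h => hT ?_
      rw [h] at hbest ⊢
      rw [(isBest_lowerContour_inter hr hb).1 hbest]
    · rfl
  · exact fun h => (h (mem_powerset.2 inter_subset_right)).elim

lemma monotonicAttention_triangularRule (hπ : IsChoiceRule π) (hr : IsPref r)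
    (hP : ∀ a b, Prel π a b → r a b) : MonotonicAttention (triangularRule π r) := by
  intro S T _ _ _ c hc hcT
  by_cases h : ∃ a ∈ S, T = lowerContour r a ∩ S
  · obtain ⟨a, ha, rfl⟩ := h
    have hca : ¬ (c = a ∨ r a c) := fun h => hcT (mem_inter.2 ⟨mem_lowerContour.2 h, hc⟩)
    have hac : a ≠ c := fun h => hca (.inl h.symm)
    have hset : lowerContour r a ∩ S = lowerContour r a ∩ S.erase c := by
      rw [inter_erase, erase_eq_of_notMem hcT]
    rw [triangularRule_lowerContour hr ha, hset,
      triangularRule_lowerContour hr (mem_erase.2 ⟨hac, ha⟩)]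
    by_contra hlt
    exact hca (.inr (hP a c ⟨hac, S, ha, hc, not_le.1 hlt⟩))
  · rw [triangularRule_eq_zero fun a ha hT => h ⟨a, ha, hT⟩]
    exact triangularRule_nonneg hπ _ _

lemma triangularRule_attentive_pair {φ : ℝ} (hφ0 : 0 < φ) (hφ1 : φ ≤ 1) (hπ : IsChoiceRule π)
    (hr : IsPref r) {a b : α} (hab : r a b) (hle : π {a, b} b ≤ φ) :
    (1 - φ) / φ * max (triangularRule π r {a, b} {a}) (triangularRule π r {a, b} {b}) ≤
      triangularRule π r {a, b} {a, b} := by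
  have hne : a ≠ b := by
    rintro rfl
    exact hr.irrefl a hab
  obtain ⟨hpos, -, hsum⟩ := hπ {a, b} ⟨a, by simp⟩
  rw [sum_pair hne] at hsum
  have hLa : lowerContour r a ∩ {a, b} = {a, b} := by
    ext x
    simp only [mem_inter, mem_lowerContour, mem_insert, mem_singleton]
    grind
  have hLb : lowerContour r b ∩ {a, b} = {b} := by
    ext x
    have := hr.asymm a b hab
    simp only [mem_inter, mem_lowerContour, mem_insert, mem_singleton]
    grind
  have h1 := triangularRule_lowerContour (π := π) hr (S := {a, b}) (a := a) (by simp)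
  have h2 := triangularRule_lowerContour (π := π) hr (S := {a, b}) (a := b) (by simp)
  have h3 : triangularRule π r {a, b} {a} = 0 := by
    refine triangularRule_eq_zero fun c hc => ?_
    rcases mem_insert.1 hc with rfl | hc
    · rw [hLa]
      exact fun h => hne.symm (mem_singleton.1 (h ▸ by simp))
    · rw [mem_singleton.1 hc, hLb]
      exact fun h => hne (singleton_injective h)
  rw [hLa] at h1
  rw [hLb] at h2
  rw [h1, h2, h3, max_eq_right (hpos b (by simp))]
  have hcoef : 0 ≤ (1 - φ) / φ := div_nonneg (by linarith) hφ0.le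
  have h4 := mul_le_mul_of_nonneg_left hle hcoef
  rw [div_mul_cancel₀ _ hφ0.ne'] at h4
  linarith

lemma attentiveAtBinaries_triangularRule {φ : ℝ} (hφ0 : 0 < φ) (hφ1 : φ ≤ 1)
    (hπ : IsChoiceRule π) (hr : IsPref r) (hP : ∀ a b, a ≠ b → φ < π {a, b} a → r a b) :
    AttentiveAtBinaries φ (triangularRule π r) := by
  intro a b hne
  rcases hr.total a b hne with hab | hba
  · refine triangularRule_attentive_pair hφ0 hφ1 hπ hr hab (not_lt.1 fun hlt => ?_)
    exact hr.asymm a b hab (hP b a hne.symm (pair_comm a b ▸ hlt))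
  · rw [pair_comm a b, max_comm]
    refine triangularRule_attentive_pair hφ0 hφ1 hπ hr hba (not_lt.1 fun hlt => ?_)
    exact hr.asymm b a hba (hP a b hne (pair_comm b a ▸ hlt))

end TriangularRule

/-- Theorem 5: For φ ∈ [1/2, 1], a choice rule `π` has a RAM
representation `(≻, μ)` with `μ` monotonic and φ-attentive at binaries iff the
relation `P^φ ∪ P` has no cycle. Here `a P^φ b` iff `a ≠ b` and
`π(a|{a,b}) > φ`. -/
theorem stmt8 (φ : ℝ) (hφ1 : 1 / 2 ≤ φ) (hφ2 : φ ≤ 1)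
    (π : Finset α → α → ℝ) (hπ : IsChoiceRule π) :
    (∃ (r : α → α → Prop) (μ : Finset α → Finset α → ℝ),
        IsRAM π r μ ∧ AttentiveAtBinaries φ μ) ↔
      ∀ a : α,
        ¬ Relation.TransGen
            (fun x y : α => (x ≠ y ∧ π {x, y} x > φ) ∨ Prel π x y) a a := by
  have hφ0 : 0 < φ := by linarith
  constructor
  · rintro ⟨r, μ, hRAM, hatt⟩ a hcycle
    have hr : IsPref r := hRAM.1.2.1
    have htrans : IsTrans α r := ⟨hr.trans⟩
    have hsub : ∀ x y : α, (x ≠ y ∧ π {x, y} x > φ) ∨ Prel π x y → r x y := by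
      rintro x y (⟨hne, hlt⟩ | hP)
      · exact pref_of_lt_binary hφ0 hRAM.1 hatt hne hlt
      · exact hP.pref hRAM
    have hcycle' : Relation.TransGen r a a := Relation.TransGen.mono hsub a a hcycle
    rw [Relation.transGen_eq_self] at hcycle'
    exact hr.irrefl a hcycle'
  · intro hacyclic
    obtain ⟨r, hr, hext⟩ := exists_isPref_extending hacyclic
    exact ⟨r, triangularRule π r, ⟨represents_triangularRule hπ hr,
      monotonicAttention_triangularRule hπ hr fun a b h => hext a b (.inr h)⟩,
      attentiveAtBinaries_triangularRule hφ0 hφ2 hπ hr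
        fun a b hne hlt => hext a b (.inl ⟨hne, hlt⟩)⟩
end

section
/- (Example 2, RAM Violation) Let X = {a, b, c} with a, b, c distinct, and let λ_a, λ_b, λ_c > 0 with λ_a + λ_b + λ_c = 1. Let π be the choice rule with π(a|{a,b,c}) = λ_a, π(b|{a,b,c}) = λ_b, π(c|{a,b,c}) = λ_c, π(a|{a,b}) = 1, π(b|{b,c}) = 1, π(c|{a,c}) = 1 (and the complementary binary probabilities equal to 0, and π(x|{x}) = 1 for each x). Then π has no RAM representation. -/
open Finset
open scoped Classical

variable {α : Type*} [Fintype α] [DecidableEq α]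

/-- In a RAM representation, the revealed-preference relation is contained in the preference. -/
theorem IsRAM.rel_of_prel {π : Finset α → α → ℝ} {r : α → α → Prop}
    {μ : Finset α → Finset α → ℝ} (h : IsRAM π r μ) {x y : α} (hxy : Prel π x y) : r x y := by
  obtain ⟨⟨-, hr, -, hrep⟩, hmono⟩ := h
  obtain ⟨hne, S, hx, hy, hlt⟩ := hxy
  by_contra hnot
  have hyx : r y x := (hr.total x y hne).resolve_left hnot
  have hx' : x ∈ S.erase y := mem_erase.2 ⟨hne, hx⟩
  rw [hrep S ⟨x, hx⟩ x hx, hrep _ ⟨x, hx'⟩ x hx'] at hlt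
  refine absurd hlt (not_lt.2 ?_)
  have hnotin : ∀ T : Finset α, IsBest r x T → y ∉ T := fun T hT hyT =>
    hr.asymm _ _ hyx (hT.2 y hyT hne.symm)
  have hsub : (S.erase y).powerset ⊆ S.powerset := powerset_mono.2 (erase_subset y S)
  rw [← sum_subset hsub]
  · refine sum_le_sum fun T hT => ?_
    split_ifs with hb
    · exact hmono S T ⟨x, hx⟩ (mem_powerset.1 (hsub hT)) ⟨x, hb.1⟩ y hy (hnotin T hb)
    · exact le_rfl
  · intro T hT hT'
    refine if_neg fun hb => hT' ?_
    exact mem_powerset.2 (subset_erase.2 ⟨mem_powerset.1 hT, hnotin T hb⟩)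

/-- Example 2, RAM Violation: With `X = {a, b, c}` and
`λ_a, λ_b, λ_c > 0` summing to 1, the choice rule with `π(x|{a,b,c}) = λ_x`,
`π(a|{a,b}) = 1`, `π(b|{b,c}) = 1`, `π(c|{a,c}) = 1` (and complementary binary
probabilities 0, singleton probabilities 1) has no RAM representation. -/
theorem stmt14 (a b c : α) (hab : a ≠ b) (hac : a ≠ c) (hbc : b ≠ c)
    (huniv : ∀ x : α, x = a ∨ x = b ∨ x = c)
    (la lb lc : ℝ) (hla : 0 < la) (hlb : 0 < lb) (hlc : 0 < lc)
    (hsum : la + lb + lc = 1)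
    (π : Finset α → α → ℝ) (hπ : IsChoiceRule π)
    (h1 : π {a, b, c} a = la) (h2 : π {a, b, c} b = lb) (h3 : π {a, b, c} c = lc)
    (h4 : π {a, b} a = 1) (h5 : π {b, c} b = 1) (h6 : π {a, c} c = 1)
    (h7 : π {a, b} b = 0) (h8 : π {b, c} c = 0) (h9 : π {a, c} a = 0)
    (h10 : ∀ x : α, π {x} x = 1) :
    ¬ ∃ (r : α → α → Prop) (μ : Finset α → Finset α → ℝ), IsRAM π r μ := by
  rintro ⟨r, μ, h⟩
  have hpref : IsPref r := h.1.2.1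
  have ea : ({a, b, c} : Finset α).erase a = {b, c} := by
    ext x; simp only [mem_erase, mem_insert, mem_singleton]; grind
  have eb : ({a, b, c} : Finset α).erase b = {a, c} := by
    ext x; simp only [mem_erase, mem_insert, mem_singleton]; grind
  have ec : ({a, b, c} : Finset α).erase c = {a, b} := by
    ext x; simp only [mem_erase, mem_insert, mem_singleton]; grind
  have rca : r c a := h.rel_of_prel
    ⟨hac.symm, {a, b, c}, by simp, by simp, by rw [ea, h3, h8]; exact hlc⟩
  have rab : r a b := h.rel_of_prel
    ⟨hab, {a, b, c}, by simp, by simp, by rw [eb, h1, h9]; exact hla⟩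
  have rbc : r b c := h.rel_of_prel
    ⟨hbc, {a, b, c}, by simp, by simp, by rw [ec, h2, h7]; exact hlb⟩
  exact hpref.asymm _ _ rca (hpref.trans _ _ _ rab rbc)
end
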